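/- Fix T* > 0 and set 𝒯 := {(t,T) ∈ ℝ² : 0 ≤ t ≤ T ≤ T*}; for (x,y) ∈ 𝒯 set 𝒯_{x,y} := {(t,T) ∈ 𝒯 : t ≤ x and T ≤ y}. Let α > 0 and γ ≥ 1 satisfy αγ > 2 and γT* > 1, and let 0 < x < y < min(α/2, T*) with γ(y − x) > 1. Define R_{α,γ}(z) := α·(log(γ·(z + e²)))³ for z ≥ 0, h(t,T) := exp(1/(x − t + y − T)) for (t,T) ∈ 𝒯_{x,y}, (t,T) ≠ (x,y), and g(t,T) := exp(−∫₀ᵗ R_{α,γ}(∫ₛᵀ h(s,u) du) ds)·h(t,T) for (t,T) ≠ (x,y), g(x,y) := 0. Suppose f is a measurable function on 𝒯_{x,y} \ {(x,y)} with values in [0, ∞) which is bounded on 𝒯_{x,y−δ} for every 0 < δ < y and satisfies f(t,T) ≥ exp(∫₀ᵗ R_{α,γ}(∫ₛᵀ f(s,u) du) ds)·g(t,T) for all (t,T) ∈ 𝒯_{x,y}, (t,T) ≠ (x,y). Then f(t,T) ≥ exp(1/(x − t + y − T)) for all (t,T) ∈ 𝒯_{x,y}, (t,T) ≠ (x,y);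 in particular f(t,T) → +∞ as (t,T) → (x,y) within 𝒯_{x,y}. -/

import Mathlib

open MeasureTheory Set Filter intervalIntegral

/-- The drift rate `R_{α,γ}(z) = α (log (γ (z + e²)))³`. -/
noncomputable def driftRate (α γ z : ℝ) : ℝ := α * Real.log (γ * (z + Real.exp 2)) ^ 3

/-- The minorant `exp (1 / (x - t + y - T))`, which blows up at `(x, y)`. -/
noncomputable def blowupKernel (x y t T : ℝ) : ℝ := Real.exp (1 / (x - t + y - T))

section DriftRate

variable {α γ : ℝ}

lemma two_le_log_drift (hγ : 1 ≤ γ) {z : ℝ} (hz : 0 ≤ z) :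
    2 ≤ Real.log (γ * (z + Real.exp 2)) := by
  have h2 := Real.exp_pos 2
  rw [Real.le_log_iff_exp_le (by positivity)]
  nlinarith

lemma log_drift_mono (hγ : 1 ≤ γ) {w z : ℝ} (hw : 0 ≤ w) (hwz : w ≤ z) :
    Real.log (γ * (w + Real.exp 2)) ≤ Real.log (γ * (z + Real.exp 2)) := by
  have h2 := Real.exp_pos 2
  apply Real.log_le_log (by positivity)
  gcongr

lemma driftRate_nonneg (hα : 0 < α) (hγ : 1 ≤ γ) {z : ℝ} (hz : 0 ≤ z) :
    0 ≤ driftRate α γ z := by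
  have := two_le_log_drift hγ hz
  unfold driftRate
  positivity

lemma driftRate_mono (hα : 0 < α) (hγ : 1 ≤ γ) {w z : ℝ} (hw : 0 ≤ w) (hwz : w ≤ z) :
    driftRate α γ w ≤ driftRate α γ z := by
  have := two_le_log_drift hγ hw
  have := log_drift_mono hγ hw hwz
  unfold driftRate
  gcongr

lemma measurable_driftRate : Measurable (driftRate α γ) := by
  unfold driftRate
  fun_prop

lemma continuousAt_driftRate (hγ : 1 ≤ γ) {z : ℝ} (hz : 0 ≤ z) :
    ContinuousAt (driftRate α γ) z := by
  have h2 := Real.exp_pos 2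
  have : γ * (z + Real.exp 2) ≠ 0 := by positivity
  unfold driftRate
  fun_prop (disch := assumption)

lemma driftRate_sub_le (hα : 0 < α) (hγ : 1 ≤ γ) {w z c d : ℝ} (hw : 0 ≤ w) (hz : 0 ≤ z)
    (hzc : z ≤ c) (hd : 0 ≤ d) (hzw : z - w ≤ d) :
    driftRate α γ z - driftRate α γ w ≤
      3 * α * Real.log (γ * (c + Real.exp 2)) ^ 2 * d := by
  have h2 := Real.exp_pos 2
  rcases le_total z w with h | h
  · have := driftRate_mono hα hγ hz h
    have : 0 ≤ 3 * α * Real.log (γ * (c + Real.exp 2)) ^ 2 * d := by positivity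
    linarith
  have hB := two_le_log_drift hγ hw
  have hBA := log_drift_mono hγ hw h
  have hAC := log_drift_mono hγ hz hzc
  have hdiff : Real.log (γ * (z + Real.exp 2)) - Real.log (γ * (w + Real.exp 2)) ≤ d := by
    rw [← Real.log_div (by positivity) (by positivity), mul_div_mul_left _ _ (by positivity)]
    refine (Real.log_le_sub_one_of_pos (by positivity)).trans ?_
    rw [div_sub_one (by positivity), div_le_iff₀ (by positivity)]
    have : (1 : ℝ) ≤ Real.exp 2 := Real.one_le_exp (by norm_num)
    nlinarith
  unfold driftRate
  generalize Real.log (γ * (z + Real.exp 2)) = A at *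
  generalize Real.log (γ * (w + Real.exp 2)) = B at *
  generalize Real.log (γ * (c + Real.exp 2)) = C at *
  have h1 : A ^ 3 - B ^ 3 ≤ 3 * C ^ 2 * d := by
    have e : A ^ 3 - B ^ 3 = (A ^ 2 + A * B + B ^ 2) * (A - B) := by ring
    rw [e]
    have : A ^ 2 + A * B + B ^ 2 ≤ 3 * C ^ 2 := by nlinarith
    have : 0 ≤ A - B := by linarith
    gcongr
  nlinarith

lemma driftRate_gain (hα : 0 < α) (hγ : 1 ≤ γ) {w z l : ℝ} (hw : 0 ≤ w) (hl : 0 ≤ l)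
    (hwz : Real.exp l * (w + Real.exp 2) ≤ z + Real.exp 2) :
    α * (3 * Real.log (γ * (w + Real.exp 2)) ^ 2 * l + l ^ 3) ≤
      driftRate α γ z - driftRate α γ w := by
  have h2 := Real.exp_pos 2
  have hB := two_le_log_drift hγ hw
  have hA : l + Real.log (γ * (w + Real.exp 2)) ≤ Real.log (γ * (z + Real.exp 2)) := by
    conv_lhs => rw [← Real.log_exp l]
    rw [← Real.log_mul (by positivity) (by positivity)]
    apply Real.log_le_log (by positivity)
    nlinarith
  unfold driftRate
  generalize Real.log (γ * (z + Real.exp 2)) = A at *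
  generalize Real.log (γ * (w + Real.exp 2)) = B at *
  have h1 : (l + B) ^ 3 ≤ A ^ 3 := by gcongr
  have h3 : 0 ≤ B * l ^ 2 := by positivity
  rw [← mul_sub]
  gcongr
  nlinarith

lemma le_of_driftRate_le (hα : 0 < α) (hγ : 1 ≤ γ) {z c : ℝ} (hz : 0 ≤ z)
    (h : driftRate α γ z ≤ c) : z ≤ Real.exp (c / α) := by
  have h2 := Real.exp_pos 2
  have hB := two_le_log_drift hγ hz
  have h3 : Real.log (γ * (z + Real.exp 2)) ≤ c / α := by
    rw [le_div_iff₀ hα]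
    unfold driftRate at h
    generalize Real.log (γ * (z + Real.exp 2)) = A at *
    have : A ≤ A ^ 3 := by nlinarith [mul_nonneg (by linarith : 0 ≤ A) (by linarith : 0 ≤ A)]
    nlinarith
  rw [Real.log_le_iff_le_exp (by positivity)] at h3
  nlinarith

end DriftRate

section ParametricIntegral

lemma measurable_intervalIntegral_param {φ : ℝ → ℝ → ℝ} (hφ : Measurable (Function.uncurry φ))
    (T : ℝ) : Measurable fun s => ∫ u in s..T, φ s u := by
  have h1 : Measurable fun s => ∫ u in Ioc s T, φ s u := by
    have hS : MeasurableSet {p : ℝ × ℝ | p.1 < p.2 ∧ p.2 ≤ T} :=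
      (measurableSet_lt measurable_fst measurable_snd).inter
        (measurableSet_le measurable_snd measurable_const)
    have := ((hφ.indicator hS).stronglyMeasurable.integral_prod_right' (ν := volume)).measurable
    convert this using 2 with s
    rw [← MeasureTheory.integral_indicator measurableSet_Ioc]
    rfl
  have h2 : Measurable fun s => ∫ u in Ioc T s, φ s u := by
    have hS : MeasurableSet {p : ℝ × ℝ | T < p.2 ∧ p.2 ≤ p.1} :=
      (measurableSet_lt measurable_const measurable_snd).inter
        (measurableSet_le measurable_snd measurable_fst)
    have := ((hφ.indicator hS).stronglyMeasurable.integral_prod_right' (ν := volume)).measurable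
    convert this using 2 with s
    rw [← MeasureTheory.integral_indicator measurableSet_Ioc]
    rfl
  exact h1.sub h2

lemma intervalIntegrable_of_bounded {g : ℝ → ℝ} (hg : Measurable g) {a b C : ℝ} (hab : a ≤ b)
    (h : ∀ s, a ≤ s → s ≤ b → 0 ≤ g s ∧ g s ≤ C) : IntervalIntegrable g volume a b := by
  rw [intervalIntegrable_iff_integrableOn_Ioc_of_le hab]
  refine Measure.integrableOn_of_bounded (M := C) (by simp) hg.aestronglyMeasurable ?_
  filter_upwards [ae_restrict_mem measurableSet_Ioc] with s hs
  obtain ⟨h1, h2⟩ := h s hs.1.le hs.2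
  rwa [Real.norm_of_nonneg h1]

variable {φ : ℝ → ℝ → ℝ} {t T C : ℝ}

lemma intervalIntegrable_slice (hφ : Measurable (Function.uncurry φ))
    (hb : ∀ s u, 0 ≤ s → s ≤ t → s ≤ u → u ≤ T → 0 ≤ φ s u ∧ φ s u ≤ C) {s : ℝ}
    (hs : 0 ≤ s) (hst : s ≤ t) (hsT : s ≤ T) : IntervalIntegrable (φ s) volume s T :=
  intervalIntegrable_of_bounded (hφ.comp measurable_prodMk_left) hsT
    fun u h1 h2 => hb s u hs hst h1 h2

lemma slice_integral_bounds (hφ : Measurable (Function.uncurry φ))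
    (hb : ∀ s u, 0 ≤ s → s ≤ t → s ≤ u → u ≤ T → 0 ≤ φ s u ∧ φ s u ≤ C) {s : ℝ}
    (hs : 0 ≤ s) (hst : s ≤ t) (hsT : s ≤ T) :
    0 ≤ ∫ u in s..T, φ s u ∧ ∫ u in s..T, φ s u ≤ T * C := by
  refine ⟨integral_nonneg hsT fun u hu => (hb s u hs hst hu.1 hu.2).1, ?_⟩
  have hC : 0 ≤ C := (hb s s hs hst le_rfl hsT).1.trans (hb s s hs hst le_rfl hsT).2
  calc ∫ u in s..T, φ s u ≤ ∫ _ in s..T, C :=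
        integral_mono_on hsT (intervalIntegrable_slice hφ hb hs hst hsT) (by simp)
          fun u hu => (hb s u hs hst hu.1 hu.2).2
    _ = (T - s) * C := by simp
    _ ≤ T * C := by gcongr; linarith

lemma intervalIntegrable_driftRate {α γ : ℝ} (hα : 0 < α) (hγ : 1 ≤ γ)
    (hφ : Measurable (Function.uncurry φ))
    (hb : ∀ s u, 0 ≤ s → s ≤ t → s ≤ u → u ≤ T → 0 ≤ φ s u ∧ φ s u ≤ C)
    (ht : 0 ≤ t) (htT : t ≤ T) :
    IntervalIntegrable (fun s => driftRate α γ (∫ u in s..T, φ s u)) volume 0 t := by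
  refine intervalIntegrable_of_bounded (C := driftRate α γ (T * C))
    (measurable_driftRate.comp (measurable_intervalIntegral_param hφ T)) ht fun s hs hst => ?_
  obtain ⟨h1, h2⟩ := slice_integral_bounds hφ hb hs hst (hst.trans htT)
  exact ⟨driftRate_nonneg hα hγ h1, driftRate_mono hα hγ h1 h2⟩

end ParametricIntegral

section Kernel

variable {x y : ℝ}

lemma blowupKernel_pos (t T : ℝ) : 0 < blowupKernel x y t T := Real.exp_pos _

lemma measurable_blowupKernel : Measurable (Function.uncurry (blowupKernel x y)) := by
  unfold blowupKernel Function.uncurry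
  fun_prop

lemma blowupKernel_le {r t T : ℝ} (hr : 0 < r) (h : r ≤ x - t + y - T) :
    blowupKernel x y t T ≤ Real.exp (1 / r) := by
  unfold blowupKernel
  gcongr

lemma blowupKernel_mono {t T T' : ℝ} (h : T ≤ T') (hr : 0 < x - t + y - T') :
    blowupKernel x y t T ≤ blowupKernel x y t T' := by
  unfold blowupKernel
  gcongr

lemma blowupKernel_bounds {r t T : ℝ} (hr : 0 < r) (h : r ≤ x - t + y - T) :
    ∀ s u, 0 ≤ s → s ≤ t → s ≤ u → u ≤ T →
      0 ≤ blowupKernel x y s u ∧ blowupKernel x y s u ≤ Real.exp (1 / r) :=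
  fun s u _ hst _ huT => ⟨(blowupKernel_pos s u).le, blowupKernel_le hr (by linarith)⟩

end Kernel

/-- A measurable field on the triangle `t ≤ T < y`, `t ≤ x`, nonnegative, bounded away from
`T = y`, which satisfies the integral inequality whose equality case is solved by
`blowupKernel x y`. -/
structure IsSupersolution (α γ x y : ℝ) (f : ℝ → ℝ → ℝ) : Prop where
  measurable : Measurable (Function.uncurry f)
  nonneg : ∀ t T, 0 ≤ t → t ≤ T → t ≤ x → T < y → 0 ≤ f t T
  bdd : ∀ Y < y, ∃ C, ∀ t T, 0 ≤ t → t ≤ T → t ≤ x → T ≤ Y → f t T ≤ C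
  le : ∀ t T, 0 ≤ t → t ≤ T → t ≤ x → T < y →
    Real.exp (∫ s in (0 : ℝ)..t, driftRate α γ (∫ u in s..T, f s u)) *
      (Real.exp (-∫ s in (0 : ℝ)..t, driftRate α γ (∫ u in s..T, blowupKernel x y s u)) *
        blowupKernel x y t T) ≤ f t T

namespace IsSupersolution

variable {α γ x y : ℝ} {f : ℝ → ℝ → ℝ}

lemma bounds (hf : IsSupersolution α γ x y f) {t T : ℝ} (htx : t ≤ x) (hT : T < y) :
    ∃ C, ∀ s u, 0 ≤ s → s ≤ t → s ≤ u → u ≤ T → 0 ≤ f s u ∧ f s u ≤ C := by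
  obtain ⟨C, hC⟩ := hf.bdd T hT
  exact ⟨C, fun s u h1 h2 h3 h4 => ⟨hf.nonneg s u h1 h3 (h2.trans htx) (h4.trans_lt hT),
    hC s u h1 h3 (h2.trans htx) h4⟩⟩

lemma integrable_slice (hf : IsSupersolution α γ x y f) {s T : ℝ} (hs : 0 ≤ s) (hsT : s ≤ T)
    (hsx : s ≤ x) (hT : T < y) : IntervalIntegrable (f s) volume s T := by
  obtain ⟨C, hC⟩ := hf.bounds hsx hT
  exact intervalIntegrable_slice hf.measurable hC hs le_rfl hsT

lemma slice_nonneg (hf : IsSupersolution α γ x y f) {s T : ℝ} (hs : 0 ≤ s) (hsT : s ≤ T)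
    (hsx : s ≤ x) (hT : T < y) : 0 ≤ ∫ u in s..T, f s u :=
  integral_nonneg hsT fun u hu => hf.nonneg s u hs hu.1 hsx (hu.2.trans_lt hT)

lemma integrable_rate (hf : IsSupersolution α γ x y f) (hα : 0 < α) (hγ : 1 ≤ γ) {t T : ℝ}
    (ht : 0 ≤ t) (htT : t ≤ T) (htx : t ≤ x) (hT : T < y) :
    IntervalIntegrable (fun s => driftRate α γ (∫ u in s..T, f s u)) volume 0 t := by
  obtain ⟨C, hC⟩ := hf.bounds htx hT
  exact intervalIntegrable_driftRate hα hγ hf.measurable hC ht htT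

end IsSupersolution

lemma integrable_kernel_slice {x y s T : ℝ} (hr : 0 < x - s + y - T) (hsT : s ≤ T) :
    IntervalIntegrable (blowupKernel x y s) volume s T :=
  intervalIntegrable_of_bounded (measurable_blowupKernel.comp measurable_prodMk_left) hsT
    fun u _ h2 => ⟨(blowupKernel_pos s u).le, blowupKernel_le hr (by linarith)⟩

lemma kernel_slice_nonneg {x y s T : ℝ} (hsT : s ≤ T) :
    0 ≤ ∫ u in s..T, blowupKernel x y s u :=
  integral_nonneg hsT fun u _ => (blowupKernel_pos s u).le

lemma integrable_kernel_rate {α γ x y t T : ℝ} (hα : 0 < α) (hγ : 1 ≤ γ) (ht : 0 ≤ t)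
    (htT : t ≤ T) (hr : 0 < x - t + y - T) :
    IntervalIntegrable (fun s => driftRate α γ (∫ u in s..T, blowupKernel x y s u))
      volume 0 t :=
  intervalIntegrable_driftRate hα hγ measurable_blowupKernel (blowupKernel_bounds hr le_rfl) ht htT

namespace IsSupersolution

variable {α γ x y : ℝ} {f : ℝ → ℝ → ℝ}

lemma exp_mul_kernel_le (hf : IsSupersolution α γ x y f) (hα : 0 < α) (hγ : 1 ≤ γ) {t T b : ℝ}
    (ht : 0 ≤ t) (htT : t ≤ T) (htx : t ≤ x) (hT : T < y)
    (hb : b ≤ ∫ s in (0 : ℝ)..t, (driftRate α γ (∫ u in s..T, f s u) -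
      driftRate α γ (∫ u in s..T, blowupKernel x y s u))) :
    Real.exp b * blowupKernel x y t T ≤ f t T := by
  refine le_trans ?_ (hf.le t T ht htT htx hT)
  rw [integral_sub (hf.integrable_rate hα hγ ht htT htx hT)
    (integrable_kernel_rate hα hγ ht htT (by linarith))] at hb
  rw [← mul_assoc, ← Real.exp_add]
  have := blowupKernel_pos (x := x) (y := y) t T
  gcongr
  linarith

/-- Comparison: a supersolution dominates the kernel off the line `T = y`. -/
theorem kernel_le (hf : IsSupersolution α γ x y f) (hα : 0 < α) (hγ : 1 ≤ γ) {t Y : ℝ}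
    (ht : 0 ≤ t) (htT : t ≤ Y) (htx : t ≤ x) (hT : Y < y) : blowupKernel x y t Y ≤ f t Y := by
  have hr : 0 < y - Y := by linarith
  have hY0 : 0 ≤ Y := ht.trans htT
  set C := Real.exp (1 / (y - Y)) with hC
  have hkC : ∀ s u, s ≤ x → u ≤ Y → blowupKernel x y s u ≤ C :=
    fun s u h1 h2 => blowupKernel_le hr (by linarith)
  have hkY : ∀ s u, 0 ≤ s → s ≤ x → s ≤ u → u ≤ Y →
      ∫ v in s..u, blowupKernel x y s v ≤ Y * C := fun s u h1 h2 h3 h4 => by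
    have := (slice_integral_bounds (T := u) measurable_blowupKernel (blowupKernel_bounds
      (x := x) (y := y) (t := s) hr (by linarith)) h1 le_rfl h3).2
    have hC0 : 0 < C := Real.exp_pos _
    nlinarith
  set B := driftRate α γ (Y * C) * x with hB
  set κ := 3 * α * Real.log (γ * (Y * C + Real.exp 2)) ^ 2 * (Y * C) with hκ
  have hYC : 0 ≤ Y * C := mul_nonneg hY0 (Real.exp_pos _).le
  have hx : 0 ≤ x := ht.trans htx
  have hB0 : 0 ≤ B := mul_nonneg (driftRate_nonneg hα hγ hYC) hx
  have hκ0 : 0 ≤ κ := by positivity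
  have main : ∀ n : ℕ, ∀ s u, 0 ≤ s → s ≤ u → s ≤ x → u ≤ Y →
      Real.exp (-(B * ((κ * s) ^ n / n.factorial))) * blowupKernel x y s u ≤ f s u := by
    intro n
    induction n with
    | zero =>
      intro s u hs hsu hsx hu
      apply hf.exp_mul_kernel_le hα hγ hs hsu hsx (by linarith)
      have : ∫ v in (0 : ℝ)..s, (-driftRate α γ (Y * C)) ≤ ∫ v in (0 : ℝ)..s,
          (driftRate α γ (∫ w in v..u, f v w) -
            driftRate α γ (∫ w in v..u, blowupKernel x y v w)) := by
        refine integral_mono_on hs (by simp) ((hf.integrable_rate hα hγ hs hsu hsx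
          (by linarith)).sub (integrable_kernel_rate hα hγ hs hsu (by linarith))) fun v hv => ?_
        have h1 := driftRate_nonneg hα hγ (hf.slice_nonneg hv.1 (hv.2.trans hsu)
          (hv.2.trans hsx) (hu.trans_lt hT))
        have h2 := driftRate_mono hα hγ (kernel_slice_nonneg (hv.2.trans hsu))
          (hkY v u hv.1 (hv.2.trans hsx) (hv.2.trans hsu) hu)
        linarith
      refine le_trans ?_ this
      have h0 := driftRate_nonneg hα hγ hYC
      simp only [pow_zero, Nat.factorial_zero, Nat.cast_one, div_one, mul_one,
        intervalIntegral.integral_const, sub_zero, smul_eq_mul]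
      nlinarith
    | succ n ih =>
      intro s u hs hsu hsx hu
      apply hf.exp_mul_kernel_le hα hγ hs hsu hsx (by linarith)
      have : ∫ v in (0 : ℝ)..s, (-(κ * (B * ((κ * v) ^ n / n.factorial)))) ≤ ∫ v in (0 : ℝ)..s,
          (driftRate α γ (∫ w in v..u, f v w) -
            driftRate α γ (∫ w in v..u, blowupKernel x y v w)) := by
        refine integral_mono_on hs (Continuous.intervalIntegrable (by fun_prop) _ _)
          ((hf.integrable_rate hα hγ hs hsu hsx
          (by linarith)).sub (integrable_kernel_rate hα hγ hs hsu (by linarith))) fun v hv => ?_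
        obtain ⟨hv0, hvs⟩ := hv
        have hvu := hvs.trans hsu
        have hvx := hvs.trans hsx
        set b := B * ((κ * v) ^ n / n.factorial) with hb
        have hb0 : 0 ≤ b := by positivity
        have hd : (∫ w in v..u, blowupKernel x y v w) - ∫ w in v..u, f v w ≤ Y * C * b := by
          rw [← integral_sub (integrable_kernel_slice (by linarith) hvu)
            (hf.integrable_slice hv0 hvu hvx (by linarith))]
          calc ∫ w in v..u, (blowupKernel x y v w - f v w) ≤ ∫ w in v..u, C * b := by
                refine integral_mono_on hvu ((integrable_kernel_slice (by linarith) hvu).sub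
                  (hf.integrable_slice hv0 hvu hvx (by linarith))) (by simp) fun w hw => ?_
                have h1 := ih v w hv0 hw.1 hvx (hw.2.trans hu)
                have h2 := Real.add_one_le_exp (-b)
                have h3 := hkC v w hvx (hw.2.trans hu)
                have h4 := blowupKernel_pos (x := x) (y := y) v w
                have h5 : (-b + 1) * blowupKernel x y v w ≤ f v w :=
                  (mul_le_mul_of_nonneg_right h2 h4.le).trans h1
                nlinarith
            _ = (u - v) * (C * b) := by rw [intervalIntegral.integral_const, smul_eq_mul]
            _ ≤ Y * C * b := by
              rw [mul_assoc]
              have : 0 ≤ C * b := mul_nonneg (Real.exp_pos _).le hb0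
              gcongr
              linarith
        have := driftRate_sub_le hα hγ (hf.slice_nonneg hv0 hvu hvx (hu.trans_lt hT))
          (kernel_slice_nonneg hvu) (hkY v u hv0 hvx hvu hu) (mul_nonneg hYC hb0) hd
        have e : 3 * α * Real.log (γ * (Y * C + Real.exp 2)) ^ 2 * (Y * C * b) = κ * b := by
          rw [hκ]; ring
        linarith
      refine le_trans (le_of_eq ?_) this
      have e : (fun v => -(κ * (B * ((κ * v) ^ n / n.factorial)))) =
          fun v => (-(κ * B * κ ^ n / n.factorial)) * v ^ n := by
        funext v; rw [mul_pow]; ring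
      rw [e, intervalIntegral.integral_const_mul, integral_pow, Nat.factorial_succ]
      push_cast
      field_simp
      simp only [ne_eq, Nat.add_eq_zero_iff, one_ne_zero, and_false, not_false_eq_true, zero_pow,
        sub_zero]
      ring
  have hlim : Tendsto (fun n : ℕ => Real.exp (-(B * ((κ * t) ^ n / n.factorial))) *
      blowupKernel x y t Y) atTop (nhds (Real.exp (-(B * 0)) * blowupKernel x y t Y)) :=
    ((Real.continuous_exp.tendsto _).comp
      ((FloorSemiring.tendsto_pow_div_factorial_atTop (κ * t)).const_mul B).neg).mul_const _
  simp only [mul_zero, neg_zero, Real.exp_zero, one_mul] at hlim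
  exact le_of_tendsto' hlim fun n => main n t Y ht htT htx le_rfl

end IsSupersolution

lemma mul_kernel_le_integral {x y s m w T : ℝ} (hsx : s ≤ x) (hsm : s ≤ m) (hmw : m ≤ w)
    (hwT : w ≤ T) (hT : T < y) :
    (T - w) * blowupKernel x y s w ≤ ∫ u in m..T, blowupKernel x y s u := by
  have hI : IntervalIntegrable (blowupKernel x y s) volume s T :=
    integrable_kernel_slice (by linarith) (hsm.trans (hmw.trans hwT))
  have hI1 : IntervalIntegrable (blowupKernel x y s) volume m T :=
    (integrable_kernel_slice (by linarith) hsm).symm.trans hI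
  have hI2 : IntervalIntegrable (blowupKernel x y s) volume w T :=
    (integrable_kernel_slice (by linarith) (hsm.trans hmw)).symm.trans hI
  calc (T - w) * blowupKernel x y s w = ∫ _ in w..T, blowupKernel x y s w := by simp
    _ ≤ ∫ u in w..T, blowupKernel x y s u :=
        integral_mono_on hwT (by simp) hI2 fun u hu =>
          blowupKernel_mono hu.1 (by linarith [hu.2])
    _ ≤ ∫ u in m..T, blowupKernel x y s u :=
        integral_mono_interval hmw hwT le_rfl
          (Eventually.of_forall fun u => (blowupKernel_pos s u).le) hI1

/-- The part of the mass of the kernel slice above `m` controls the whole slice as soon as the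
kernel at `m` is controlled by its value at some `w` above `m`. -/
lemma kernel_slice_le_mul_tail {x y s m w T c : ℝ} (hs : 0 ≤ s) (hsx : s ≤ x)
    (hsm : s ≤ m) (hmw : m ≤ w) (hwT : w ≤ T) (hT : T < y)
    (hc0 : 0 ≤ c)
    (hc : (y + Real.exp 2) * blowupKernel x y s m ≤ c * ((T - w) * blowupKernel x y s w)) :
    (∫ u in s..T, blowupKernel x y s u) + Real.exp 2 ≤
      (c + 1) * ∫ u in m..T, blowupKernel x y s u := by
  have hmT := hmw.trans hwT
  have hI : IntervalIntegrable (blowupKernel x y s) volume s T :=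
    integrable_kernel_slice (by linarith) (hsm.trans hmT)
  have hI1 : IntervalIntegrable (blowupKernel x y s) volume s m :=
    integrable_kernel_slice (by linarith) hsm
  have hI2 : IntervalIntegrable (blowupKernel x y s) volume m T := hI1.symm.trans hI
  have h1 : ∫ u in s..m, blowupKernel x y s u ≤ y * blowupKernel x y s m := by
    calc ∫ u in s..m, blowupKernel x y s u ≤ ∫ _ in s..m, blowupKernel x y s m :=
          integral_mono_on hsm hI1 (by simp) fun u hu =>
            blowupKernel_mono hu.2 (by linarith)
      _ = (m - s) * blowupKernel x y s m := by simp
      _ ≤ _ := mul_le_mul_of_nonneg_right (by linarith) (blowupKernel_pos _ _).le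
  have h2 := mul_kernel_le_integral hsx hsm hmw hwT hT
  have h3 : 1 ≤ blowupKernel x y s m :=
    Real.one_le_exp (one_div_nonneg.2 (by linarith))
  have h4 := integral_add_adjacent_intervals hI1 hI2
  have h5 := Real.exp_pos 2
  nlinarith [mul_le_mul_of_nonneg_left h2 hc0]

/-- On the square of side `d` at the corner, at least half of the mass of a kernel slice sits
above `y - d`, and the logarithm in the drift rate is at least of order `1 / d`. -/
lemma kernel_corner_bounds {γ x y d s T : ℝ} (hγ : 1 ≤ γ) (hd0 : 0 < d) (hdx : d ≤ x)
    (hdy : d ≤ y - x) (hd : y + Real.exp 2 ≤ d / 4 * Real.exp (1 / (16 * d)))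
    (h1 : x - d ≤ s) (h2 : s ≤ x) (h3 : y - d / 2 ≤ T) (h4 : T < y) :
    (∫ u in s..T, blowupKernel x y s u) + Real.exp 2 ≤
        (1 + 1) * ∫ u in (y - d)..T, blowupKernel x y s u ∧
      1 / (4 * d) ≤ Real.log (γ * ((∫ u in s..T, blowupKernel x y s u) + Real.exp 2)) := by
  set C := y + Real.exp 2 with hC
  have hC1 : 1 ≤ C := by linarith [Real.add_one_le_exp 2]
  have hTw : d / 4 ≤ T - (y - 3 * d / 4) := by linarith
  have hexp : Real.exp (1 / (16 * d)) * blowupKernel x y s (y - d) ≤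
      blowupKernel x y s (y - 3 * d / 4) := by
    unfold blowupKernel
    rw [← Real.exp_add]
    gcongr
    have e1 : x - s + y - (y - d) = (x - s) + d := by ring
    have e2 : x - s + y - (y - 3 * d / 4) = (x - s) + 3 * d / 4 := by ring
    have hv0 : 0 ≤ x - s := by linarith
    have hv1 : x - s ≤ d := by linarith
    rw [e1, e2]
    generalize x - s = v at *
    have e3 : 1 / (v + 3 * d / 4) - 1 / (v + d) = (d / 4) / ((v + 3 * d / 4) * (v + d)) := by
      field_simp
      ring
    have e4 : 1 / (16 * d) = (d / 4) / ((2 * d) * (2 * d)) := by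
      field_simp
      norm_num
    have e5 : (d / 4) / ((2 * d) * (2 * d)) ≤ (d / 4) / ((v + 3 * d / 4) * (v + d)) := by
      gcongr <;> linarith
    linarith
  have hpos := blowupKernel_pos (x := x) (y := y) s (y - d)
  refine ⟨kernel_slice_le_mul_tail (w := y - 3 * d / 4) (by linarith) h2 (by linarith)
    (by linarith) (by linarith) h4 zero_le_one ?_, ?_⟩
  · rw [one_mul]
    calc C * blowupKernel x y s (y - d)
        ≤ d / 4 * Real.exp (1 / (16 * d)) * blowupKernel x y s (y - d) :=
          mul_le_mul_of_nonneg_right hd hpos.le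
      _ = d / 4 * (Real.exp (1 / (16 * d)) * blowupKernel x y s (y - d)) := by ring
      _ ≤ (T - (y - 3 * d / 4)) * blowupKernel x y s (y - 3 * d / 4) :=
        mul_le_mul hTw hexp (by positivity) (by linarith)
  · have hH := mul_kernel_le_integral (m := s) (w := y - 3 * d / 4) h2 le_rfl (by linarith)
      (by linarith) h4
    have hk : Real.exp (1 / (16 * d)) * Real.exp (1 / (4 * d)) ≤
        blowupKernel x y s (y - 3 * d / 4) := by
      unfold blowupKernel
      rw [← Real.exp_add]
      gcongr
      calc 1 / (16 * d) + 1 / (4 * d) = 5 / 16 / d := by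
            field_simp
            norm_num
        _ ≤ 1 / 2 / d := div_le_div_of_nonneg_right (by norm_num) hd0.le
        _ = 1 / (2 * d) := by field_simp
        _ ≤ _ := by
            gcongr <;> linarith
    have h5 : Real.exp (1 / (4 * d)) ≤ ∫ u in s..T, blowupKernel x y s u := by
      calc Real.exp (1 / (4 * d)) ≤ C * Real.exp (1 / (4 * d)) :=
            le_mul_of_one_le_left (Real.exp_pos _).le hC1
        _ ≤ d / 4 * Real.exp (1 / (16 * d)) * Real.exp (1 / (4 * d)) :=
          mul_le_mul_of_nonneg_right hd (Real.exp_pos _).le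
        _ = d / 4 * (Real.exp (1 / (16 * d)) * Real.exp (1 / (4 * d))) := by ring
        _ ≤ (T - (y - 3 * d / 4)) * blowupKernel x y s (y - 3 * d / 4) :=
          mul_le_mul hTw hk (by positivity) (by linarith)
        _ ≤ _ := hH
    have h6 := Real.exp_pos 2
    have h7 := Real.exp_pos (1 / (4 * d))
    have h8 := h7.trans_le h5
    rw [Real.le_log_iff_exp_le (by positivity)]
    nlinarith

/-- The numerical inequalities which make the gap exponent quadruple at each amplification. -/
lemma amplification_estimates {α c C d : ℝ} (hα : 0 < α) (hc0 : 0 < c) (hC0 : 0 < C)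
    (hd0 : 0 < d) (hd5 : d ≤ α * c ^ 2 / 256) (hd6 : d ≤ c ^ 2 / (128 * C)) (n : ℕ) :
    Real.log (C / (d / 8 * (1 / 2) ^ n) + 1) ≤ 4 ^ n * (c / d) / 2 ∧
      4 ^ (n + 1) * (c / d) ≤ d / 8 * (1 / 2) ^ n * (α * (4 ^ n * (c / d) / 2) ^ 3) := by
  have h6 : (1 : ℝ) ≤ 4 ^ n * 4 ^ n * (1 / 2) ^ n := by
    rw [← mul_pow, ← mul_pow]
    exact one_le_pow₀ (by norm_num)
  have hp : (0 : ℝ) < (1 / 2) ^ n := by positivity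
  have hm : (0 : ℝ) < 4 ^ n := by positivity
  rw [pow_succ]
  generalize ((1 : ℝ) / 2) ^ n = p at *
  generalize (4 : ℝ) ^ n = m at *
  constructor
  · rw [Real.log_le_iff_le_exp (by positivity)]
    have h1 := Real.quadratic_le_exp_of_nonneg (x := m * (c / d) / 2) (by positivity)
    have h0 : 0 < m * (c / d) / 2 := by positivity
    have h2 : C / (d / 8 * p) ≤ (m * (c / d) / 2) ^ 2 / 2 := by
      have e : (m * (c / d) / 2) ^ 2 / 2 * (d / 8 * p) = c ^ 2 / (64 * d) * (m * m * p) := by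
        field_simp
        norm_num
      have h4 : C ≤ c ^ 2 / (64 * d) := by
        rw [le_div_iff₀ (by positivity)] at hd6 ⊢
        nlinarith
      rw [div_le_iff₀ (by positivity), e]
      nlinarith
    linarith
  · have e1 : d / 8 * p * (α * (m * (c / d) / 2) ^ 3) =
        (α * c ^ 2 / (64 * d)) * (m * m * p) * (m * (c / d)) := by
      field_simp
      norm_num
    have h5 : 4 ≤ α * c ^ 2 / (64 * d) := by
      rw [le_div_iff₀ (by positivity)]
      linarith
    have h7 : 4 ≤ (α * c ^ 2 / (64 * d)) * (m * m * p) := by nlinarith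
    have h8 : 0 < m * (c / d) := by positivity
    rw [e1]
    nlinarith

namespace IsSupersolution

variable {α γ x y : ℝ} {f : ℝ → ℝ → ℝ}

lemma kernel_integral_le (hf : IsSupersolution α γ x y f) (hα : 0 < α) (hγ : 1 ≤ γ) {s T : ℝ}
    (hs : 0 ≤ s) (hsT : s ≤ T) (hsx : s ≤ x) (hT : T < y) :
    ∫ u in s..T, blowupKernel x y s u ≤ ∫ u in s..T, f s u :=
  integral_mono_on hsT (integrable_kernel_slice (by linarith) hsT)
    (hf.integrable_slice hs hsT hsx hT)
    fun _ hu => hf.kernel_le hα hγ hs hu.1 hsx (hu.2.trans_lt hT)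

lemma rate_diff_nonneg (hf : IsSupersolution α γ x y f) (hα : 0 < α) (hγ : 1 ≤ γ) {s T : ℝ}
    (hs : 0 ≤ s) (hsT : s ≤ T) (hsx : s ≤ x) (hT : T < y) :
    0 ≤ driftRate α γ (∫ u in s..T, f s u) -
      driftRate α γ (∫ u in s..T, blowupKernel x y s u) :=
  sub_nonneg.2 (driftRate_mono hα hγ (kernel_slice_nonneg hsT)
    (hf.kernel_integral_le hα hγ hs hsT hsx hT))

lemma integrable_rate_diff (hf : IsSupersolution α γ x y f) (hα : 0 < α) (hγ : 1 ≤ γ) {t T : ℝ}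
    (ht : 0 ≤ t) (htT : t ≤ T) (htx : t ≤ x) (hT : T < y) :
    IntervalIntegrable (fun s => driftRate α γ (∫ u in s..T, f s u) -
      driftRate α γ (∫ u in s..T, blowupKernel x y s u)) volume 0 t :=
  (hf.integrable_rate hα hγ ht htT htx hT).sub
    (integrable_kernel_rate hα hγ ht htT (by linarith))

/-- The lower bound on the exponent of `f / blowupKernel` obtained from a subinterval. -/
lemma integral_rate_diff_mono (hf : IsSupersolution α γ x y f) (hα : 0 < α) (hγ : 1 ≤ γ)
    {a b t T : ℝ} (ha : 0 ≤ a) (hab : a ≤ b) (hbt : b ≤ t) (htT : t ≤ T) (htx : t ≤ x)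
    (hT : T < y) :
    ∫ s in a..b, (driftRate α γ (∫ u in s..T, f s u) -
        driftRate α γ (∫ u in s..T, blowupKernel x y s u)) ≤
      ∫ s in (0 : ℝ)..t, (driftRate α γ (∫ u in s..T, f s u) -
        driftRate α γ (∫ u in s..T, blowupKernel x y s u)) := by
  refine integral_mono_interval ha hab hbt ?_
    (hf.integrable_rate_diff hα hγ (ha.trans (hab.trans hbt)) htT htx hT)
  filter_upwards [ae_restrict_mem measurableSet_Ioc] with s hs
  exact hf.rate_diff_nonneg hα hγ hs.1.le (hs.2.trans htT) (hs.2.trans htx) hT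

/-- Amplification: a multiplicative gap between `f` and the kernel on a square at the corner
`(x, y)` yields another gap on a smaller square. -/
lemma amplify (hf : IsSupersolution α γ x y f) (hα : 0 < α) (hγ : 1 ≤ γ)
    {d d' c L l q : ℝ} (hd' : 0 < d') (hdd : d' < d) (hdx : d ≤ x) (hdy : d ≤ y - x)
    (hL : ∀ t T, x - d ≤ t → t ≤ x → y - d ≤ T → T < y →
      Real.exp L * blowupKernel x y t T ≤ f t T)
    (hc : 0 ≤ c)
    (htail : ∀ s T, x - d ≤ s → s ≤ x → y - d' ≤ T → T < y →
      (∫ u in s..T, blowupKernel x y s u) + Real.exp 2 ≤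
        (c + 1) * ∫ u in (y - d)..T, blowupKernel x y s u)
    (hl : 0 ≤ l) (hlL : l ≤ L - Real.log (c + 1))
    (hq : ∀ s T, x - d ≤ s → s ≤ x → y - d' ≤ T → T < y →
      q ≤ α * (3 * Real.log (γ * ((∫ u in s..T, blowupKernel x y s u) + Real.exp 2)) ^ 2 * l
        + l ^ 3)) :
    ∀ t T, x - d' ≤ t → t ≤ x → y - d' ≤ T → T < y →
      Real.exp ((d - d') * q) * blowupKernel x y t T ≤ f t T := by
  intro t T ht htx hTd hT
  have htT : t ≤ T := by linarith
  apply hf.exp_mul_kernel_le hα hγ (by linarith) htT htx hT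
  refine le_trans ?_ (hf.integral_rate_diff_mono hα hγ (a := x - d) (b := x - d')
    (by linarith) (by linarith) ht htT htx hT)
  calc (d - d') * q = ∫ _ in (x - d)..(x - d'), q := by simp
    _ ≤ _ := integral_mono_on (by linarith) (by simp)
      ((hf.integrable_rate_diff hα hγ (by linarith) htT htx hT).mono_set (by
        rw [uIcc_of_le (by linarith), uIcc_of_le (by linarith)]
        exact Icc_subset_Icc (by linarith) ht)) fun s hs => ?_
  obtain ⟨hs1, hs2⟩ := hs
  have hs0 : 0 ≤ s := by linarith
  have hsx : s ≤ x := by linarith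
  have hsm : s ≤ y - d := by linarith
  have hmT : y - d ≤ T := by linarith
  refine (hq s T hs1 hsx hTd hT).trans
    (driftRate_gain hα hγ (kernel_slice_nonneg (hsm.trans hmT)) hl ?_)
  have hI1 : IntervalIntegrable (blowupKernel x y s) volume s (y - d) :=
    integrable_kernel_slice (by linarith) hsm
  have hI2 : IntervalIntegrable (blowupKernel x y s) volume (y - d) T :=
    hI1.symm.trans (integrable_kernel_slice (by linarith) (hsm.trans hmT))
  have hJ1 := hf.integrable_slice hs0 hsm hsx (by linarith)
  have hJ2 : IntervalIntegrable (f s) volume (y - d) T :=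
    hJ1.symm.trans (hf.integrable_slice hs0 (hsm.trans hmT) hsx hT)
  have e1 := integral_add_adjacent_intervals hI1 hI2
  have e2 := integral_add_adjacent_intervals hJ1 hJ2
  have h1 := hf.kernel_integral_le hα hγ hs0 hsm hsx (by linarith)
  have h2 : Real.exp L * ∫ u in (y - d)..T, blowupKernel x y s u ≤ ∫ u in (y - d)..T, f s u := by
    rw [← intervalIntegral.integral_const_mul]
    exact integral_mono_on hmT (hI2.const_mul _) hJ2 fun u hu =>
      hL s u hs1 hsx hu.1 (hu.2.trans_lt hT)
  have h3 := htail s T hs1 hsx hTd hT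
  have h4 : Real.exp l * (c + 1) ≤ Real.exp L := by
    rw [← Real.exp_log (by linarith : 0 < c + 1), ← Real.exp_add]
    exact Real.exp_le_exp.2 (by linarith)
  have h5 : 1 ≤ Real.exp l := Real.one_le_exp hl
  have hI0 : 0 ≤ ∫ u in (y - d)..T, blowupKernel x y s u :=
    integral_nonneg hmT fun u _ => (blowupKernel_pos s u).le
  rw [← e1, ← e2] at *
  generalize (∫ u in (y - d)..T, blowupKernel x y s u) = I at *
  generalize (∫ u in s..(y - d), blowupKernel x y s u) = J at *
  nlinarith [mul_le_mul_of_nonneg_right h4 hI0,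
    mul_le_mul_of_nonneg_left h3 (by linarith : 0 ≤ Real.exp l - 1), Real.exp_pos 2]

/-- Once `f` exceeds the kernel by the factor `e²` near the corner `(x, y)`, it exceeds it by
an arbitrarily large factor on a fixed square, which is absurd. -/
theorem false_of_gap (hf : IsSupersolution α γ x y f) (hα : 0 < α) (hγ : 1 ≤ γ) (hx : 0 < x)
    (hxy : x < y) {d₀ : ℝ} (hd₀ : 0 < d₀)
    (hgap : ∀ t T, x - d₀ ≤ t → t ≤ x → y - d₀ ≤ T → T < y →
      Real.exp 2 * blowupKernel x y t T ≤ f t T) : False := by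
  set C := y + Real.exp 2 with hC
  have hC0 : 0 < C := by have := Real.exp_pos 2; linarith
  set c := 3 * α / 32 with hc
  have hc0 : 0 < c := by positivity
  have hsmall : ∀ᶠ d in nhdsWithin (0 : ℝ) (Ioi 0), C ≤ d / 4 * Real.exp (1 / (16 * d)) := by
    have h1 : Tendsto (fun d : ℝ => 1 / 16 * d⁻¹) (nhdsWithin (0 : ℝ) (Ioi 0)) atTop :=
      tendsto_inv_nhdsGT_zero.const_mul_atTop (by norm_num)
    filter_upwards [((Real.tendsto_exp_div_pow_atTop 1).comp h1).eventually_ge_atTop (64 * C),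
      self_mem_nhdsWithin] with d hd hd0
    have hd0 : 0 < d := hd0
    have e : 1 / 16 * d⁻¹ = 1 / (16 * d) := by field_simp
    simp only [Function.comp_apply, pow_one, e] at hd
    rw [le_div_iff₀ (by positivity)] at hd
    have : 64 * C * (1 / (16 * d)) = C / (d / 4) := by field_simp; norm_num
    rw [this, div_le_iff₀ (by positivity)] at hd
    linarith
  have hlt : ∀ b > (0 : ℝ), ∀ᶠ d in nhdsWithin (0 : ℝ) (Ioi 0), d ≤ b := fun b hb =>
    nhdsWithin_le_nhds (Iic_mem_nhds hb)
  obtain ⟨d, hd1, hd2, hd3, hd4, hd5, hd6, hd0⟩ := (hsmall.and ((hlt d₀ hd₀).and ((hlt x hx).and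
    ((hlt (y - x) (by linarith)).and ((hlt (α * c ^ 2 / 256) (by positivity)).and
    ((hlt (c ^ 2 / (128 * C)) (by positivity)).and self_mem_nhdsWithin)))))).exists
  have hd0 : 0 < d := hd0
  have base : ∀ t T, x - d / 2 ≤ t → t ≤ x → y - d / 2 ≤ T → T < y →
      Real.exp (c / d) * blowupKernel x y t T ≤ f t T := by
    have := hf.amplify hα hγ (d := d) (d' := d / 2) (c := 1) (L := 2) (l := 1)
      (q := α * (3 * (1 / (4 * d)) ^ 2)) (by positivity) (by linarith) hd3 hd4
      (fun t T h1 h2 h3 h4 => hgap t T (by linarith) h2 (by linarith) h4) zero_le_one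
      (fun s T h1 h2 h3 h4 => (kernel_corner_bounds hγ hd0 hd3 hd4 hd1 h1 h2 h3 h4).1) zero_le_one
      (by have := Real.log_le_sub_one_of_pos (x := 1 + 1) (by norm_num); linarith)
      (fun s T h1 h2 h3 h4 => by
        have h5 := (kernel_corner_bounds hγ hd0 hd3 hd4 hd1 h1 h2 h3 h4).2
        have : (1 / (4 * d)) ^ 2 ≤
          Real.log (γ * ((∫ u in s..T, blowupKernel x y s u) + Real.exp 2)) ^ 2 := by gcongr
        gcongr
        linarith)
    have e : (d - d / 2) * (α * (3 * (1 / (4 * d)) ^ 2)) = c / d := by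
      rw [hc]
      field_simp
      norm_num
    rwa [e] at this
  have iter : ∀ n : ℕ, ∀ t T, x - (d / 4 + d / 4 * (1 / 2) ^ n) ≤ t → t ≤ x →
      y - (d / 4 + d / 4 * (1 / 2) ^ n) ≤ T → T < y →
      Real.exp (4 ^ n * (c / d)) * blowupKernel x y t T ≤ f t T := by
    intro n
    induction n with
    | zero =>
      intro t T h1 h2 h3 h4
      simp only [pow_zero, one_mul]
      exact base t T (by linarith) h2 (by linarith) h4
    | succ n ih =>
      have hp : (0 : ℝ) < (1 / 2) ^ n := by positivity
      have hp1 : ((1 : ℝ) / 2) ^ n ≤ 1 := pow_le_one₀ (by norm_num) (by norm_num)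
      have hps : ((1 : ℝ) / 2) ^ (n + 1) = (1 / 2) ^ n / 2 := by rw [pow_succ]; ring
      set δ := d / 8 * (1 / 2) ^ n with hδ
      have hδ0 : 0 < δ := by positivity
      have hdn : d / 4 + d / 4 * (1 / 2) ^ n = d / 4 + 2 * δ := by rw [hδ]; ring
      have hdn' : d / 4 + d / 4 * (1 / 2) ^ (n + 1) = d / 4 + δ := by rw [hδ, hps]; ring
      have hδd : δ ≤ d / 8 := mul_le_of_le_one_right (by positivity) hp1
      rw [hdn] at ih
      rw [hdn']
      obtain ⟨hlog, hgain⟩ := amplification_estimates hα hc0 hC0 hd0 hd5 hd6 n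
      rw [← hδ] at hlog hgain
      have hl0 : 0 < 4 ^ n * (c / d) / 2 := by positivity
      intro t T h1 h2 h3 h4
      have := hf.amplify hα hγ (d := d / 4 + 2 * δ) (d' := d / 4 + δ) (c := C / δ)
        (L := 4 ^ n * (c / d)) (l := 4 ^ n * (c / d) / 2)
        (q := α * (4 ^ n * (c / d) / 2) ^ 3) (by positivity) (by linarith)
        (by linarith) (by linarith) ih (by positivity)
        (fun s T h1 h2 h3 h4 => by
          refine kernel_slice_le_mul_tail (w := y - (d / 4 + 2 * δ)) (by linarith) h2
            (by linarith) le_rfl (by linarith) h4 (by positivity) ?_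
          have hpos := blowupKernel_pos (x := x) (y := y) s (y - (d / 4 + 2 * δ))
          have h5 : C ≤ C / δ * (T - (y - (d / 4 + 2 * δ))) := by
            rw [div_mul_eq_mul_div, le_div_iff₀ hδ0]
            gcongr
            linarith
          rw [← mul_assoc (C / δ)]
          exact mul_le_mul_of_nonneg_right h5 hpos.le)
        hl0.le (by linarith)
        (fun s T _ _ _ _ => by
          refine mul_le_mul_of_nonneg_left (le_add_of_nonneg_left ?_) hα.le
          positivity) t T h1 h2 h3 h4
      refine le_trans ?_ this
      refine mul_le_mul_of_nonneg_right (Real.exp_le_exp.2 (hgain.trans (le_of_eq ?_)))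
        (blowupKernel_pos t T).le
      ring
  have hfin : ∀ n : ℕ, Real.exp (4 ^ n * (c / d)) * blowupKernel x y x (y - d / 4) ≤
      f x (y - d / 4) := fun n => by
    have : 0 < d / 4 * (1 / 2) ^ n := by positivity
    exact iter n _ _ (by linarith) le_rfl (by linarith) (by linarith)
  have htop : Tendsto (fun n : ℕ => Real.exp (4 ^ n * (c / d)) * blowupKernel x y x (y - d / 4))
      atTop atTop :=
    (Real.tendsto_exp_atTop.comp ((tendsto_pow_atTop_atTop_of_one_lt (by norm_num)).atTop_mul_const
      (by positivity))).atTop_mul_const (blowupKernel_pos _ _)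
  obtain ⟨n, hn⟩ := (htop.eventually_gt_atTop (f x (y - d / 4))).exists
  exact absurd (hfin n) (not_le.2 hn)

lemma slice_integral_mono (hf : IsSupersolution α γ x y f) {s T T' : ℝ} (hs : 0 ≤ s)
    (hsx : s ≤ x) (hsT : s ≤ T) (hTT : T ≤ T') (hT' : T' < y) :
    ∫ u in s..T, f s u ≤ ∫ u in s..T', f s u := by
  refine integral_mono_interval le_rfl hsT hTT ?_
    (hf.integrable_slice hs (hsT.trans hTT) hsx hT')
  filter_upwards [ae_restrict_mem measurableSet_Ioc] with u hu
  exact hf.nonneg s u hs hu.1.le hsx (hu.2.trans_lt hT')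

/-- The exponent in the integral inequality stays bounded as `T` increases to `y`. -/
theorem exists_integral_rate_le (hf : IsSupersolution α γ x y f) (hα : 0 < α) (hγ : 1 ≤ γ)
    (hx : 0 < x) (hxy : x < y) {t : ℝ} (ht : 0 ≤ t) (htx : t < x) :
    ∃ M, ∀ T, t ≤ T → T < y →
      ∫ s in (0 : ℝ)..t, driftRate α γ (∫ u in s..T, f s u) ≤ M := by
  by_contra! hM
  set b := driftRate α γ (y * Real.exp (1 / (x - t))) with hb
  obtain ⟨T₀, htT₀, hT₀, hlarge⟩ := hM (t * b + 2)
  have hmin : 0 < min (x - t) (y - T₀) := lt_min (by linarith) (by linarith)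
  refine hf.false_of_gap hα hγ hx hxy (d₀ := min (min (x - t) (y - T₀)) (y - x))
    (lt_min hmin (by linarith)) fun r T h1 h2 h3 h4 => ?_
  have h5 : min (min (x - t) (y - T₀)) (y - x) ≤ x - t :=
    (min_le_left _ _).trans (min_le_left _ _)
  have h6 : min (min (x - t) (y - T₀)) (y - x) ≤ y - T₀ :=
    (min_le_left _ _).trans (min_le_right _ _)
  have h7 : min (min (x - t) (y - T₀)) (y - x) ≤ y - x := min_le_right _ _
  have htr : t ≤ r := by linarith
  have hrT : r ≤ T := by linarith
  have hTT : T₀ ≤ T := by linarith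
  apply hf.exp_mul_kernel_le hα hγ (ht.trans htr) hrT h2 h4
  refine le_trans ?_ (hf.integral_rate_diff_mono hα hγ le_rfl ht htr hrT h2 h4)
  rw [integral_sub (hf.integrable_rate hα hγ ht (htr.trans hrT) htx.le h4)
    (integrable_kernel_rate hα hγ ht (htr.trans hrT) (by linarith))]
  have hF : ∫ s in (0 : ℝ)..t, driftRate α γ (∫ u in s..T₀, f s u) ≤
      ∫ s in (0 : ℝ)..t, driftRate α γ (∫ u in s..T, f s u) :=
    integral_mono_on ht (hf.integrable_rate hα hγ ht htT₀ htx.le hT₀)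
      (hf.integrable_rate hα hγ ht (htr.trans hrT) htx.le h4) fun s hs =>
        driftRate_mono hα hγ (hf.slice_nonneg hs.1 (hs.2.trans htT₀) (hs.2.trans htx.le) hT₀)
          (hf.slice_integral_mono hs.1 (hs.2.trans htx.le) (hs.2.trans htT₀) hTT h4)
  have hH : ∫ s in (0 : ℝ)..t, driftRate α γ (∫ u in s..T, blowupKernel x y s u) ≤ t * b := by
    calc _ ≤ ∫ _ in (0 : ℝ)..t, b :=
          integral_mono_on ht (integrable_kernel_rate hα hγ ht (htr.trans hrT) (by linarith))
            (by simp) fun s hs => ?_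
      _ = t * b := by simp
    refine driftRate_mono hα hγ (kernel_slice_nonneg (hs.2.trans (htr.trans hrT))) ?_
    refine (slice_integral_bounds measurable_blowupKernel (blowupKernel_bounds
      (r := x - t) (t := t) (by linarith) (by linarith)) hs.1 hs.2
      (hs.2.trans (htr.trans hrT))).2.trans ?_
    gcongr
  linarith

/-- On the line `T = y` the inner integrals of `f` are finite for almost every `s`, the outer
one is finite, and it dominates the one of the kernel. -/
theorem integral_kernel_rate_le (hf : IsSupersolution α γ x y f) (hα : 0 < α) (hγ : 1 ≤ γ)
    (hx : 0 < x) (hxy : x < y) {t : ℝ} (ht : 0 ≤ t) (htx : t < x) :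
    ∫ s in (0 : ℝ)..t, driftRate α γ (∫ u in s..y, blowupKernel x y s u) ≤
      ∫ s in (0 : ℝ)..t, driftRate α γ (∫ u in s..y, f s u) := by
  obtain ⟨M, hM⟩ := hf.exists_integral_rate_le hα hγ hx hxy ht htx
  obtain ⟨T, hTmono, hTlt, hTlim⟩ := exists_seq_strictMono_tendsto' hxy
  have hTt : ∀ n, t ≤ T n := fun n => htx.le.trans (hTlt n).1.le
  set F : ℕ → ℝ → ℝ := fun n s => driftRate α γ (∫ u in s..(T n), f s u) with hF
  set G : ℝ → ℝ := fun s => driftRate α γ (∫ u in s..y, f s u) with hG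
  have hFm : ∀ n, Measurable (F n) := fun n =>
    measurable_driftRate.comp (measurable_intervalIntegral_param hf.measurable _)
  have hGm : Measurable G :=
    measurable_driftRate.comp (measurable_intervalIntegral_param hf.measurable _)
  set μ := volume.restrict (Ioc 0 t) with hμ
  have hF0 : ∀ n, ∀ s ∈ Ioc 0 t, 0 ≤ F n s := fun n s hs =>
    driftRate_nonneg hα hγ (hf.slice_nonneg hs.1.le (hs.2.trans (hTt n)) (hs.2.trans htx.le)
      (hTlt n).2)
  have hFmono : ∀ s ∈ Ioc 0 t, Monotone fun n => F n s := fun s hs m n hmn =>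
    driftRate_mono hα hγ (hf.slice_nonneg hs.1.le (hs.2.trans (hTt m)) (hs.2.trans htx.le)
      (hTlt m).2) (hf.slice_integral_mono hs.1.le (hs.2.trans htx.le) (hs.2.trans (hTt m))
        (hTmono.monotone hmn) (hTlt n).2)
  have hmem : ∀ᵐ s ∂μ, s ∈ Ioc 0 t := ae_restrict_mem measurableSet_Ioc
  have hsup : ∫⁻ s, ⨆ n, ENNReal.ofReal (F n s) ∂μ ≤ ENNReal.ofReal M := by
    rw [lintegral_iSup' (fun n => (hFm n).ennreal_ofReal.aemeasurable)
      (hmem.mono fun s hs m n hmn => ENNReal.ofReal_le_ofReal (hFmono s hs hmn))]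
    refine iSup_le fun n => ?_
    have hint := hf.integrable_rate hα hγ ht (hTt n) htx.le (hTlt n).2
    rw [← ofReal_integral_eq_lintegral_ofReal
      ((intervalIntegrable_iff_integrableOn_Ioc_of_le ht).1 hint) (hmem.mono (hF0 n))]
    have := hM (T n) (hTt n) (hTlt n).2
    rw [intervalIntegral.integral_of_le ht] at this
    exact ENNReal.ofReal_le_ofReal this
  have hfin : ∀ᵐ s ∂μ, ⨆ n, ENNReal.ofReal (F n s) < ⊤ :=
    ae_lt_top' (Measurable.iSup fun n => (hFm n).ennreal_ofReal).aemeasurable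
      (hsup.trans_lt ENNReal.ofReal_lt_top).ne
  have hslice : ∀ᵐ s ∂μ, IntegrableOn (f s) (Ioc s y) volume := by
    filter_upwards [hfin, hmem] with s hs hst
    have hsx : s ≤ x := hst.2.trans htx.le
    refine integrableOn_Ioc_of_intervalIntegral_norm_bounded_right (l := atTop) (b := T)
      (I := Real.exp ((⨆ n, ENNReal.ofReal (F n s)).toReal / α)) (fun n => ?_) hTlim
      (Eventually.of_forall fun n => ?_)
    · exact (intervalIntegrable_iff_integrableOn_Ioc_of_le (hst.2.trans (hTt n))).1
        (hf.integrable_slice hst.1.le (hst.2.trans (hTt n)) hsx (hTlt n).2)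
    · have h1 : F n s ≤ (⨆ n, ENNReal.ofReal (F n s)).toReal := by
        rw [← ENNReal.ofReal_le_iff_le_toReal hs.ne]
        exact le_iSup (fun n => ENNReal.ofReal (F n s)) n
      have h2 := le_of_driftRate_le hα hγ (hf.slice_nonneg hst.1.le (hst.2.trans (hTt n)) hsx
        (hTlt n).2) h1
      refine le_trans (le_of_eq ?_) h2
      rw [intervalIntegral.integral_of_le (hst.2.trans (hTt n))]
      refine setIntegral_congr_fun measurableSet_Ioc fun u hu => ?_
      exact Real.norm_of_nonneg (hf.nonneg s u hst.1.le hu.1.le hsx (hu.2.trans_lt (hTlt n).2))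
  have hyslice : ∀ᵐ s ∂μ, 0 ≤ ∫ u in s..y, f s u := by
    filter_upwards [hslice, hmem] with s hs hst
    have hsy : s ≤ y := hst.2.trans (htx.le.trans hxy.le)
    have := integral_mono_on_of_le_Ioo hsy (f := fun _ => (0 : ℝ)) (g := f s) (μ := volume)
      (by simp) ((intervalIntegrable_iff_integrableOn_Ioc_of_le hsy).2 hs) fun u hu =>
        hf.nonneg s u hst.1.le hu.1.le (hst.2.trans htx.le) hu.2
    simpa using this
  have hGsup : ∀ᵐ s ∂μ, ENNReal.ofReal (G s) ≤ ⨆ n, ENNReal.ofReal (F n s) := by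
    filter_upwards [hslice, hyslice, hmem] with s hs hs0 hst
    have hsy : s ≤ y := hst.2.trans (htx.le.trans hxy.le)
    have hcont := continuousOn_primitive_interval (a := s) (b := y) (f := f s) (μ := volume)
      (by rwa [uIcc_of_le hsy, integrableOn_Icc_iff_integrableOn_Ioc])
    have h1 : Tendsto (fun n => ∫ u in s..(T n), f s u) atTop (nhds (∫ u in s..y, f s u)) := by
      refine (hcont y right_mem_uIcc).tendsto.comp
        (tendsto_nhdsWithin_iff.2 ⟨hTlim, Eventually.of_forall fun n => ?_⟩)
      rw [uIcc_of_le hsy]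
      exact ⟨hst.2.trans (hTt n), (hTlt n).2.le⟩
    have h2 : Tendsto (fun n => ENNReal.ofReal (F n s)) atTop (nhds (ENNReal.ofReal (G s))) :=
      (ENNReal.continuous_ofReal.tendsto _).comp
        ((continuousAt_driftRate hγ hs0).tendsto.comp h1)
    exact le_of_tendsto' h2 fun n => le_iSup (fun n => ENNReal.ofReal (F n s)) n
  have hG0 : ∀ᵐ s ∂μ, 0 ≤ G s := hyslice.mono fun s hs => driftRate_nonneg hα hγ hs
  have hGint : Integrable G μ := by
    rw [← lintegral_ofReal_ne_top_iff_integrable hGm.aestronglyMeasurable hG0]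
    exact ((lintegral_mono_ae hGsup).trans_lt (hsup.trans_lt ENNReal.ofReal_lt_top)).ne
  rw [intervalIntegral.integral_of_le ht, intervalIntegral.integral_of_le ht]
  refine integral_mono_ae ((intervalIntegrable_iff_integrableOn_Ioc_of_le ht).1
    (integrable_kernel_rate hα hγ ht (htx.le.trans hxy.le) (by linarith))) hGint ?_
  filter_upwards [hslice, hmem] with s hs hst
  have hsy : s ≤ y := hst.2.trans (htx.le.trans hxy.le)
  have hsx : s < x := hst.2.trans_lt htx
  exact driftRate_mono hα hγ (kernel_slice_nonneg hsy)
    (integral_mono_on_of_le_Ioo hsy (integrable_kernel_slice (by linarith) hsy)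
      ((intervalIntegrable_iff_integrableOn_Ioc_of_le hsy).2 hs)
      fun u hu => hf.kernel_le hα hγ hst.1.le hu.1.le hsx.le hu.2)

end IsSupersolution

lemma tendsto_blowupKernel_atTop {x y : ℝ} {S : Set (ℝ × ℝ)}
    (hS : ∀ p ∈ S, 0 < x - p.1 + y - p.2) :
    Tendsto (fun p : ℝ × ℝ => blowupKernel x y p.1 p.2) (nhdsWithin (x, y) S) atTop := by
  have h1 : Tendsto (fun p : ℝ × ℝ => x - p.1 + y - p.2) (nhdsWithin (x, y) S)
      (nhdsWithin 0 (Ioi 0)) := by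
    refine tendsto_nhdsWithin_iff.2 ⟨?_, ?_⟩
    · have : Continuous fun p : ℝ × ℝ => x - p.1 + y - p.2 := by fun_prop
      have h := this.tendsto (x, y)
      simp only [sub_self, zero_add] at h
      exact h.mono_left nhdsWithin_le_nhds
    · filter_upwards [self_mem_nhdsWithin] with p hp using hS p hp
  have h2 := Real.tendsto_exp_atTop.comp (tendsto_inv_nhdsGT_zero.comp h1)
  refine h2.congr fun p => ?_
  simp [blowupKernel]

/-- blow-up of locally bounded supersolutions: any nonnegative
measurable field on `𝒯_{x,y} \ {(x,y)}`, bounded on each `𝒯_{x,y−δ}`, which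
dominates `exp(∫₀ᵗ R_{α,γ}(∫ₛᵀ f) ds)·g` (with `g` built from the blowing-up
minorant `h(t,T) = exp(1/(x−t+y−T))`) dominates `h` itself; in particular it
tends to `+∞` at `(x,y)`. -/
theorem stmt16 (Tstar : ℝ) (hTstar : 0 < Tstar)
    (α γ x y : ℝ) (hα : 0 < α) (hγ : 1 ≤ γ) (hαγ : 2 < α * γ) (hγT : 1 < γ * Tstar)
    (hx : 0 < x) (hxy : x < y) (hy : y < min (α / 2) Tstar) (hgap : 1 < γ * (y - x))
    (f : ℝ → ℝ → ℝ) (hf_meas : Measurable (Function.uncurry f))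
    (hf_nonneg : ∀ t T, 0 ≤ t → t ≤ T → T ≤ Tstar → t ≤ x → T ≤ y → (t, T) ≠ (x, y) →
      0 ≤ f t T)
    (hf_locbdd : ∀ δ, 0 < δ → δ < y → ∃ C : ℝ, ∀ t T,
      0 ≤ t → t ≤ T → T ≤ Tstar → t ≤ x → T ≤ y - δ → f t T ≤ C)
    (hf_ineq : ∀ t T, 0 ≤ t → t ≤ T → T ≤ Tstar → t ≤ x → T ≤ y → (t, T) ≠ (x, y) →
      Real.exp (∫ s in (0 : ℝ)..t,
          α * Real.log (γ * ((∫ u in s..T, f s u) + Real.exp 2)) ^ 3)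
        * (Real.exp (-∫ s in (0 : ℝ)..t,
            α * Real.log (γ * ((∫ u in s..T, Real.exp (1 / (x - s + y - u))) + Real.exp 2)) ^ 3)
          * Real.exp (1 / (x - t + y - T))) ≤ f t T) :
    (∀ t T, 0 ≤ t → t ≤ T → T ≤ Tstar → t ≤ x → T ≤ y → (t, T) ≠ (x, y) →
      Real.exp (1 / (x - t + y - T)) ≤ f t T) ∧
    Tendsto (fun p : ℝ × ℝ => f p.1 p.2)
      (nhdsWithin (x, y)
        ({p : ℝ × ℝ | 0 ≤ p.1 ∧ p.1 ≤ p.2 ∧ p.2 ≤ Tstar ∧ p.1 ≤ x ∧ p.2 ≤ y} \ {(x, y)}))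
      atTop := by
  have hyT : y < Tstar := hy.trans_le (min_le_right _ _)
  have hf : IsSupersolution α γ x y f :=
    { measurable := hf_meas
      nonneg := fun t T h1 h2 h3 h4 => hf_nonneg t T h1 h2 (h4.trans hyT).le h3 h4.le
        fun h => h4.ne (Prod.ext_iff.1 h).2
      bdd := fun Y hY => by
        have hm : 0 < min (y - Y) (y / 2) := lt_min (by linarith) (by linarith)
        obtain ⟨C, hC⟩ := hf_locbdd _ hm ((min_le_right _ _).trans_lt (by linarith))
        have hle : min (y - Y) (y / 2) ≤ y - Y := min_le_left _ _
        exact ⟨C, fun t T h1 h2 h3 h4 => hC t T h1 h2 (by linarith) h3 (by linarith)⟩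
      le := fun t T h1 h2 h3 h4 => hf_ineq t T h1 h2 (h4.trans hyT).le h3 h4.le
        fun h => h4.ne (Prod.ext_iff.1 h).2 }
  have hmain : ∀ t T, 0 ≤ t → t ≤ T → T ≤ Tstar → t ≤ x → T ≤ y → (t, T) ≠ (x, y) →
      blowupKernel x y t T ≤ f t T := by
    intro t T h1 h2 h3 h4 h5 h6
    rcases h5.lt_or_eq with h | rfl
    · exact hf.kernel_le hα hγ h1 h2 h4 h
    · have htx : t < x := lt_of_le_of_ne h4 fun h => h6 (by rw [h])
      refine le_trans ?_ (hf_ineq t T h1 h2 h3 h4 h5 h6)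
      have := hf.integral_kernel_rate_le hα hγ hx hxy h1 htx
      rw [← mul_assoc, ← Real.exp_add]
      refine le_mul_of_one_le_left (blowupKernel_pos t T).le (Real.one_le_exp ?_)
      unfold driftRate blowupKernel at this
      linarith
  refine ⟨hmain, tendsto_atTop_mono' _ ?_ (tendsto_blowupKernel_atTop fun p hp => ?_)⟩
  · filter_upwards [self_mem_nhdsWithin] with p hp
    exact hmain p.1 p.2 hp.1.1 hp.1.2.1 hp.1.2.2.1 hp.1.2.2.2.1 hp.1.2.2.2.2 hp.2
  · obtain ⟨⟨-, -, -, h4, h5⟩, h6⟩ := hp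
    by_contra! h
    exact h6 (Prod.ext (by simp only; linarith) (by simp only; linarith))
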